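/- arXiv:1304.0604 — 10 statements merged into one kernel-verified Lean document; each statement's English description precedes it below -/
import Mathlib

section
/- For all real numbers α ≥ 0 and β ≥ 0, the function γ ↦ (1/2)·min{ γ·max{1,β} + 2(1−γ), γ + (1−γ)·(max{1,α} + max{1−α,0}), γ·max{α, max{β,1}} + 2(1−γ)·max{α, 1−α} } attains a maximum on the interval [0,1], and this maximum value equals d_SYM(α,β). -/
/-- The gDoF of the interference-symmetric Gaussian half-duplex causal
cognitive interference channel (Theorem 1). -/
noncomputable def dSYM (α β : ℝ) : ℝ :=
  if α < 1/2 then 1 - α + (1/2) * (α * max (β - 2 + 2*α) 0 / (β + α - 1))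
  else if α < 2/3 then α + (1/2) * ((2 - 3*α) * max (β - 2*α) 0 / (β - 3*α + 1))
  else if α < 2 then max (1 - α/2) (α/2)
  else 1 + (1/2) * ((α - 2) * max (β - 2) 0 / (β + α - 3))

/-- A function on the unit interval that equals the minimum of an increasing affine function
`a + p * γ` and a nonincreasing one `b - q * γ` is maximal where the two lines cross. -/
theorem isGreatest_image_of_crossing {f : ℝ → ℝ} {a b p q : ℝ} (hp : 0 < p) (hq : 0 ≤ q)
    (hab : a ≤ b) (hba : b - a ≤ p + q)
    (hf : ∀ γ ∈ Set.Icc (0 : ℝ) 1, f γ = (1/2) * min (a + p * γ) (b - q * γ)) :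
    IsGreatest (f '' Set.Icc 0 1) ((1/2) * (a + (b - a) * p / (p + q))) := by
  have hpq : 0 < p + q := by linarith
  constructor
  · have hmem : (b - a) / (p + q) ∈ Set.Icc (0 : ℝ) 1 :=
      ⟨div_nonneg (by linarith) hpq.le, (div_le_one hpq).2 hba⟩
    refine ⟨_, hmem, ?_⟩
    have hcross : b - q * ((b - a) / (p + q)) = a + p * ((b - a) / (p + q)) := by
      field_simp
      ring
    rw [hf _ hmem, hcross, min_self]
    ring
  · rintro _ ⟨γ, hγ, rfl⟩
    rw [hf γ hγ]
    have h₁ := mul_le_mul_of_nonneg_left (min_le_left (a + p * γ) (b - q * γ)) hq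
    have h₂ := mul_le_mul_of_nonneg_left (min_le_right (a + p * γ) (b - q * γ)) hp.le
    have h : min (a + p * γ) (b - q * γ) ≤ a + (b - a) * p / (p + q) := by
      rw [← sub_le_iff_le_add', le_div_iff₀ hpq]
      linarith
    linarith

/-- A function on the unit interval bounded above by its value at `0` is maximal there. -/
theorem isGreatest_image_of_le_zero {f : ℝ → ℝ} {v : ℝ} (h0 : f 0 = v)
    (hf : ∀ γ ∈ Set.Icc (0 : ℝ) 1, f γ ≤ v) : IsGreatest (f '' Set.Icc 0 1) v :=
  ⟨⟨0, by simp, h0⟩, by rintro _ ⟨γ, hγ, rfl⟩; exact hf γ hγ⟩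

/-- The max over γ ∈ [0,1] of the three-term min equals d_SYM(α,β). -/
theorem stmt_0 (α β : ℝ) (hα : 0 ≤ α) (hβ : 0 ≤ β) :
    IsGreatest
      ((fun γ : ℝ => (1/2) * min (γ * max 1 β + 2 * (1 - γ))
        (min (γ + (1 - γ) * (max 1 α + max (1 - α) 0))
          (γ * max α (max β 1) + 2 * (1 - γ) * max α (1 - α)))) '' Set.Icc 0 1)
      (dSYM α β) := by
  unfold dSYM
  split_ifs with h1 h2 h3
  · rw [max_eq_left (by linarith : α ≤ 1), max_eq_left (by linarith : 0 ≤ 1 - α),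
      max_eq_right (by linarith : α ≤ 1 - α),
      max_eq_right (by linarith [le_max_right β 1] : α ≤ max β 1), max_comm β 1]
    rcases le_or_gt β (2 - 2 * α) with hb | hb
    · rw [max_eq_right (by linarith : β - 2 + 2 * α ≤ 0)]
      have hM : max 1 β ≤ 2 - 2 * α := max_le (by linarith) hb
      refine isGreatest_image_of_le_zero ?_ ?_
      · rw [min_eq_right ((min_le_right _ _).trans (by linarith)), min_eq_right (by linarith)]
        ring
      · rintro γ ⟨hγ0, hγ1⟩
        have := (min_le_right (γ * max 1 β + 2 * (1 - γ)) _).trans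
          (min_le_right (γ + (1 - γ) * (1 + (1 - α))) (γ * max 1 β + 2 * (1 - γ) * (1 - α)))
        have := mul_le_mul_of_nonneg_left hM hγ0
        simp only [mul_zero, zero_div]
        linarith
    · rw [max_eq_left (by linarith : 0 ≤ β - 2 + 2 * α), max_eq_right (by linarith : 1 ≤ β)]
      convert isGreatest_image_of_crossing (a := 2 - 2 * α) (b := 2 - α) (p := β - 2 + 2 * α)
        (q := 1 - α) (by linarith) (by linarith) (by linarith) (by linarith) ?_ using 1
      · rw [show β - 2 + 2 * α + (1 - α) = β + α - 1 by ring]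
        ring
      · rintro γ ⟨hγ0, hγ1⟩
        have := mul_nonneg hα (sub_nonneg.2 hγ1)
        rw [min_eq_right ((min_le_right _ _).trans (by linarith)), min_comm]
        ring_nf
  · rw [not_lt] at h1
    rw [max_eq_left (by linarith : α ≤ 1), max_eq_left (by linarith : 0 ≤ 1 - α),
      max_eq_left (by linarith : 1 - α ≤ α),
      max_eq_right (by linarith [le_max_right β 1] : α ≤ max β 1), max_comm β 1]
    rcases le_or_gt β (2 * α) with hb | hb
    · rw [max_eq_right (by linarith : β - 2 * α ≤ 0)]
      have hM : max 1 β ≤ 2 * α := max_le (by linarith) hb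
      refine isGreatest_image_of_le_zero ?_ ?_
      · rw [min_eq_right ((min_le_right _ _).trans (by linarith)), min_eq_right (by linarith)]
        ring
      · rintro γ ⟨hγ0, hγ1⟩
        have := (min_le_right (γ * max 1 β + 2 * (1 - γ)) _).trans
          (min_le_right (γ + (1 - γ) * (1 + (1 - α))) (γ * max 1 β + 2 * (1 - γ) * α))
        have := mul_le_mul_of_nonneg_left hM hγ0
        simp only [mul_zero, zero_div]
        linarith
    · rw [max_eq_left (by linarith : 0 ≤ β - 2 * α), max_eq_right (by linarith : 1 ≤ β)]
      convert isGreatest_image_of_crossing (a := 2 * α) (b := 2 - α) (p := β - 2 * α)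
        (q := 1 - α) (by linarith) (by linarith) (by linarith) (by linarith) ?_ using 1
      · rw [show β - 2 * α + (1 - α) = β - 3 * α + 1 by ring]
        ring
      · rintro γ ⟨hγ0, hγ1⟩
        have := mul_nonneg (by linarith : 0 ≤ 1 - α) (sub_nonneg.2 hγ1)
        rw [min_eq_right ((min_le_right _ _).trans (by linarith)), min_comm]
        ring_nf
  · rw [not_lt] at h1 h2
    rw [max_eq_left (by linarith : 1 - α ≤ α)]
    have hmax : max 1 α + max (1 - α) 0 = 2 * max (1 - α / 2) (α / 2) := by
      rcases le_total α 1 with h | h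
      · rw [max_eq_left h, max_eq_left (by linarith), max_eq_left (by linarith)]
        ring
      · rw [max_eq_right h, max_eq_right (by linarith), max_eq_right (by linarith)]
        ring
    have hlo : 1 / 2 ≤ max (1 - α / 2) (α / 2) := by
      linarith [le_max_left (1 - α / 2) (α / 2), le_max_right (1 - α / 2) (α / 2)]
    have hhi : max (1 - α / 2) (α / 2) ≤ 1 := max_le (by linarith) (by linarith)
    have hhi' : max (1 - α / 2) (α / 2) ≤ α := max_le (by linarith) (by linarith)
    rw [hmax]
    refine isGreatest_image_of_le_zero ?_ ?_
    · rw [min_eq_right ((min_le_left _ _).trans (by linarith)), min_eq_left (by linarith)]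
      ring
    · rintro γ ⟨hγ0, hγ1⟩
      have := (min_le_right (γ * max 1 β + 2 * (1 - γ)) _).trans
        (min_le_left (γ + (1 - γ) * (2 * max (1 - α / 2) (α / 2)))
          (γ * max α (max β 1) + 2 * (1 - γ) * α))
      have := mul_le_mul_of_nonneg_left hlo hγ0
      linarith
  · rw [not_lt] at h3
    rw [max_eq_right (by linarith : 1 ≤ α), max_eq_right (by linarith : 1 - α ≤ 0),
      max_eq_left (by linarith : 1 - α ≤ α), max_comm β 1]
    rcases le_or_gt β 2 with hb | hb
    · rw [max_eq_right (by linarith : β - 2 ≤ 0)]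
      have hM : max 1 β ≤ 2 := max_le (by linarith) hb
      refine isGreatest_image_of_le_zero ?_ ?_
      · rw [min_eq_left (le_min _ _)] <;> simp <;> linarith
      · rintro γ ⟨hγ0, hγ1⟩
        have := min_le_left (γ * max 1 β + 2 * (1 - γ)) (min (γ + (1 - γ) * (α + 0))
          (γ * max α (max 1 β) + 2 * (1 - γ) * α))
        have := mul_le_mul_of_nonneg_left hM hγ0
        simp only [mul_zero, zero_div]
        linarith
    · rw [max_eq_left (by linarith : 0 ≤ β - 2), max_eq_right (by linarith : 1 ≤ β)]
      convert isGreatest_image_of_crossing (a := 2) (b := α) (p := β - 2)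
        (q := α - 1) (by linarith) (by linarith) (by linarith) (by linarith) ?_ using 1
      · rw [show β - 2 + (α - 1) = β + α - 3 by ring]
        ring
      · rintro γ ⟨hγ0, hγ1⟩
        have := mul_le_mul_of_nonneg_left (le_max_right α β) hγ0
        have := mul_nonneg (by linarith : 0 ≤ α - 1) (sub_nonneg.2 hγ1)
        rw [← min_assoc, min_eq_left ((min_le_left _ _).trans (by linarith))]
        ring_nf
end

section
/- For all real numbers α ≥ 0 and β ≥ 0, the function γ ↦ (1/2)·min{ γ·max{1,β} + 2(1−γ), γ + (1−γ)·(max{1,α} + max{1−α,0}) } attains a maximum on the interval [0,1], and this maximum value equals d_Z(α,β). -/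
/-- The gDoF of the Z-channel (Theorem 2). -/
noncomputable def dZ (α β : ℝ) : ℝ :=
  if α < 2 then max (1 - α/2) (α/2)
  else 1 + (1/2) * ((α - 2) * max (β - 2) 0 / (β + α - 3))

/-- The max over γ ∈ [0,1] of the two-term min equals d_Z(α,β). -/
theorem stmt_1 (α β : ℝ) (hα : 0 ≤ α) (hβ : 0 ≤ β) :
    IsGreatest
      ((fun γ : ℝ => (1/2) * min (γ * max 1 β + 2 * (1 - γ))
        (γ + (1 - γ) * (max 1 α + max (1 - α) 0))) '' Set.Icc 0 1)
      (dZ α β) := by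
  unfold dZ
  split_ifs with h
  · have hM : max 1 α + max (1 - α) 0 = 2 * max (1 - α / 2) (α / 2) := by
      rcases le_total α 1 with h1 | h1
      · rw [max_eq_left h1, max_eq_left (by linarith), max_eq_left (by linarith)]; ring
      · rw [max_eq_right h1, max_eq_right (by linarith), max_eq_right (by linarith)]; ring
    have hM_le : max (1 - α / 2) (α / 2) ≤ 1 := max_le (by linarith) (by linarith)
    have hM_ge : 1 / 2 ≤ max (1 - α / 2) (α / 2) := by
      linarith [le_max_left (1 - α / 2) (α / 2), le_max_right (1 - α / 2) (α / 2)]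
    rw [hM]
    generalize max (1 - α / 2) (α / 2) = M at *
    constructor
    · refine ⟨0, by norm_num, ?_⟩
      dsimp only
      rw [min_eq_right (by linarith)]
      ring
    · rintro _ ⟨γ, ⟨h0, -⟩, rfl⟩
      dsimp only
      nlinarith [min_le_right (γ * max 1 β + 2 * (1 - γ)) (γ + (1 - γ) * (2 * M))]
  · push Not at h
    rw [max_eq_right (by linarith : 1 ≤ α), max_eq_right (by linarith : 1 - α ≤ 0), add_zero]
    rcases le_or_gt β 2 with hb | hb
    · rw [max_eq_right (by linarith : β - 2 ≤ 0), mul_zero, zero_div]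
      have hB : max 1 β ≤ 2 := max_le (by norm_num) hb
      constructor
      · refine ⟨0, by norm_num, ?_⟩
        dsimp only
        rw [min_eq_left (by linarith)]
        ring
      · rintro _ ⟨γ, ⟨h0, -⟩, rfl⟩
        dsimp only
        nlinarith [min_le_left (γ * max 1 β + 2 * (1 - γ)) (γ + (1 - γ) * α)]
    · rw [max_eq_left (by linarith : 0 ≤ β - 2), max_eq_right (by linarith : 1 ≤ β)]
      have hD : 0 < β + α - 3 := by linarith
      constructor
      · refine ⟨(α - 2) / (β + α - 3),
          ⟨div_nonneg (by linarith) hD.le, (div_le_one hD).2 (by linarith)⟩, ?_⟩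
        dsimp only
        rw [min_eq_left (le_of_eq (by field_simp; ring))]
        field_simp
        ring
      · rintro _ ⟨γ, -, rfl⟩
        dsimp only
        have h1 := min_le_left (γ * β + 2 * (1 - γ)) (γ + (1 - γ) * α)
        have h2 := min_le_right (γ * β + 2 * (1 - γ)) (γ + (1 - γ) * α)
        generalize min (γ * β + 2 * (1 - γ)) (γ + (1 - γ) * α) = m at *
        have hm : m - 2 ≤ (α - 2) * (β - 2) / (β + α - 3) := by
          rw [le_div_iff₀ hD]
          linarith [mul_le_mul_of_nonneg_left h1 (by linarith : 0 ≤ α - 1),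
            mul_le_mul_of_nonneg_left h2 (by linarith : 0 ≤ β - 2)]
        linarith
end

section
/- For all real numbers α ≥ 0 and β ≥ 0, the function γ ↦ (1/2)·min{ γ + 2(1−γ), γ·max{β, max{α,1}} + (1−γ)·(max{1,α} + max{1−α,0}) } attains a maximum on the interval [0,1], and this maximum value equals d_S(α,β). -/
/-- The gDoF of the S-channel (Theorem 3). -/
noncomputable def dS (α β : ℝ) : ℝ :=
  if α < 1 then 1 - α/2 + (1/2) * (α * max (α + β - 2) 0 / (β + α - 1))
  else if α < 2 then α/2 + (1/2) * ((2 - α) * max (β - α) 0 / (β - α + 1))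
  else 1

/-- The maximum over `[0, 1]` of the minimum of `2 - γ` and a line with intercept `c ≤ 2` and
slope `s`. -/
theorem isGreatest_half_min_line (c s : ℝ) (hc : c ≤ 2) (hcs : 0 < s → 2 - c ≤ 1 + s) :
    IsGreatest ((fun γ : ℝ => (1/2) * min (2 - γ) (c + γ * s)) '' Set.Icc 0 1)
      (c/2 + (1/2) * ((2 - c) * max s 0 / (s + 1))) := by
  rcases le_or_gt s 0 with hs | hs
  · rw [max_eq_right hs]
    refine ⟨⟨0, by simp, ?_⟩, ?_⟩
    · simp [min_eq_right hc]
      ring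
    · rintro _ ⟨γ, ⟨h0, -⟩, rfl⟩
      have := min_le_right (2 - γ) (c + γ * s)
      simp only [mul_zero, zero_div, add_zero]
      nlinarith [mul_nonneg h0 (neg_nonneg.2 hs)]
  · rw [max_eq_left hs.le]
    have hs1 : 0 < s + 1 := by linarith
    obtain ⟨γ₀, hγ₀⟩ : ∃ γ₀, γ₀ = (2 - c) / (s + 1) := ⟨_, rfl⟩
    have hmul : γ₀ * (s + 1) = 2 - c := by rw [hγ₀]; field_simp
    have hval : c/2 + (1/2) * ((2 - c) * s / (s + 1)) = (1/2) * (2 - γ₀) := by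
      rw [mul_div_right_comm, ← hγ₀]
      linarith
    rw [hval]
    refine ⟨⟨γ₀, ⟨?_, ?_⟩, ?_⟩, ?_⟩
    · rw [hγ₀]
      exact div_nonneg (by linarith) hs1.le
    · rw [hγ₀, div_le_one hs1]
      linarith [hcs hs]
    · have h : c + γ₀ * s = 2 - γ₀ := by linarith
      simp [h]
    · rintro _ ⟨γ, -, rfl⟩
      have h₁ := min_le_left (2 - γ) (c + γ * s)
      have h₂ := min_le_right (2 - γ) (c + γ * s)
      dsimp only
      rcases le_total γ γ₀ with h | h
      · nlinarith
      · linarith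

/-- The max over γ ∈ [0,1] of the two-term min equals d_S(α,β). -/
theorem stmt_2 (α β : ℝ) (hα : 0 ≤ α) (hβ : 0 ≤ β) :
    IsGreatest
      ((fun γ : ℝ => (1/2) * min (γ + 2 * (1 - γ))
        (γ * max β (max α 1) + (1 - γ) * (max 1 α + max (1 - α) 0))) '' Set.Icc 0 1)
      (dS α β) := by
  unfold dS
  split_ifs with h₁ h₂
  · have hmax : max (max β 1 + α - 2) 0 = max (α + β - 2) 0 := by
      rcases le_total β 1 with h | h
      · rw [max_eq_right h, max_eq_right (by linarith), max_eq_right (by linarith)]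
      · rw [max_eq_left h, add_comm β α]
    convert isGreatest_half_min_line (2 - α) (max β 1 + α - 2) (by linarith)
      (fun _ => by linarith [le_max_right β 1]) using 1
    · congr 1
      funext γ
      rw [max_eq_right h₁.le, max_eq_left h₁.le, max_eq_left (by linarith : 0 ≤ 1 - α)]
      congr 2 <;> ring
    · rw [hmax]
      rcases le_total β 1 with h | h
      · rw [max_eq_right (by linarith : α + β - 2 ≤ 0)]
        simp
        ring
      · rw [max_eq_left h, show β + α - 2 + 1 = β + α - 1 by ring]
        ring
  · rw [not_lt] at h₁
    have hmax : max β α - α = max (β - α) 0 := by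
      rw [← max_sub_sub_right, sub_self]
    convert isGreatest_half_min_line α (max β α - α) h₂.le
      (fun _ => by linarith [le_max_right β α]) using 1
    · congr 1
      funext γ
      rw [max_eq_left h₁, max_eq_right h₁, max_eq_right (by linarith : 1 - α ≤ 0)]
      congr 2 <;> ring
    · rw [hmax]
      rcases le_total β α with h | h
      · simp [max_eq_right (sub_nonpos.2 h)]
      · simp [max_eq_left (sub_nonneg.2 h)]
  · rw [not_lt] at h₁ h₂
    rw [max_eq_left h₁, max_eq_right h₁, max_eq_right (by linarith : 1 - α ≤ 0)]
    refine ⟨⟨0, by simp, ?_⟩, ?_⟩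
    · simp [min_eq_left h₂]
    · rintro _ ⟨γ, ⟨h0, -⟩, rfl⟩
      dsimp only
      linarith [min_le_left (γ + 2 * (1 - γ)) (γ * max β α + (1 - γ) * (α + 0))]
end

section
/- For all real numbers α and β with 0 < α < 2/3 and β ≥ 0, one has d_SYM(α,β) > max{1−α, α} if and only if β > 2·max{1−α, α}. -/
/-- A truncated gain term is positive exactly when its truncated factor is, provided its
denominator is positive there. -/
theorem half_mul_max_div_pos_iff {c t d : ℝ} (hc : 0 < c) (hd : 0 < t → 0 < d) :
    0 < (1/2) * (c * max t 0 / d) ↔ 0 < t := by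
  constructor
  · intro h
    by_contra! ht
    simp [max_eq_right ht] at h
  · intro ht
    have := hd ht
    rw [max_eq_left ht.le]
    positivity

/-- In very weak interference (α < 2/3), cooperation strictly improves the gDoF
iff the cooperation exponent exceeds the non-cooperative sum-gDoF. -/
theorem stmt_8 (α β : ℝ) (hα₁ : 0 < α) (hα₂ : α < 2/3) (hβ : 0 ≤ β) :
    dSYM α β > max (1 - α) α ↔ β > 2 * max (1 - α) α := by
  unfold dSYM
  rw [gt_iff_lt, gt_iff_lt]
  split_ifs with h
  · rw [max_eq_left (by linarith : α ≤ 1 - α), lt_add_iff_pos_right,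
      half_mul_max_div_pos_iff hα₁ fun ht => by linarith]
    constructor <;> intro <;> linarith
  · rw [max_eq_right (by linarith : 1 - α ≤ α), lt_add_iff_pos_right,
      half_mul_max_div_pos_iff (by linarith) fun ht => by linarith, sub_pos]
end

section
/- For all real numbers α ≥ 0 and β ≥ 0, one has min{1, max{1−α, α}, max{1−α/2, α/2}} ≤ d_SYM(α,β) ≤ max{1−α/2, α/2}. -/
theorem mul_max_zero_div_mem_Icc {c x d : ℝ} (hc : 0 ≤ c) (h : x ≤ d) :
    c * max x 0 / d ∈ Set.Icc 0 c := by
  rcases le_total x 0 with hx | hx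
  · simp [max_eq_right hx, hc]
  · have hd : 0 ≤ d := hx.trans h
    rw [max_eq_left hx, mul_div_assoc]
    exact ⟨mul_nonneg hc (div_nonneg hx hd), mul_le_of_le_one_right hc (div_le_one_of_le₀ h hd)⟩

/-- Sandwich: d^(NoCoop) ≤ d^(SYM) ≤ d^(Ideal). -/
theorem stmt_10 (α β : ℝ) (hα : 0 ≤ α) (hβ : 0 ≤ β) :
    min 1 (min (max (1 - α) α) (max (1 - α/2) (α/2))) ≤ dSYM α β ∧
    dSYM α β ≤ max (1 - α/2) (α/2) := by
  unfold dSYM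
  split_ifs with h₁ h₂ h₃
  · obtain ⟨hl, hu⟩ := mul_max_zero_div_mem_Icc (x := β - 2 + 2*α) (d := β + α - 1) hα
      (by linarith)
    refine ⟨(min_le_right _ _).trans ((min_le_left _ _).trans ?_), le_max_of_le_left ?_⟩
    · exact max_le (by linarith) (by linarith)
    · linarith
  · obtain ⟨hl, hu⟩ := mul_max_zero_div_mem_Icc (c := 2 - 3*α) (x := β - 2*α)
      (d := β - 3*α + 1) (by linarith) (by linarith)
    refine ⟨(min_le_right _ _).trans ((min_le_left _ _).trans ?_), le_max_of_le_left ?_⟩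
    · exact max_le (by linarith) (by linarith)
    · linarith
  · exact ⟨(min_le_right _ _).trans (min_le_right _ _), le_rfl⟩
  · obtain ⟨hl, hu⟩ := mul_max_zero_div_mem_Icc (c := α - 2) (x := β - 2)
      (d := β + α - 3) (by linarith) (by linarith)
    exact ⟨(min_le_left _ _).trans (by linarith), le_max_of_le_right (by linarith)⟩
end

section
/- For all real numbers α ≥ 0 and β ≥ 0, one has d_Z(α,β) > min{1, max{1−α/2, α/2}} if and only if (α > 2 and β > 2). -/
/-- For the Z-channel, cooperation strictly improves the gDoF iff α > 2 and β > 2. -/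
theorem stmt_13 (α β : ℝ) (hα : 0 ≤ α) (hβ : 0 ≤ β) :
    dZ α β > min 1 (max (1 - α/2) (α/2)) ↔ (2 < α ∧ 2 < β) := by
  unfold dZ
  split_ifs with h
  · have hmax : max (1 - α/2) (α/2) ≤ 1 := max_le (by linarith) (by linarith)
    rw [min_eq_right hmax]
    exact ⟨fun hlt => (lt_irrefl _ hlt).elim, fun hαβ => (lt_asymm h hαβ.1).elim⟩
  · have hmax : 1 ≤ max (1 - α/2) (α/2) := le_max_of_le_right (by linarith)
    rw [min_eq_left hmax]
    constructor
    · intro hlt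
      constructor
      · by_contra hα2
        have hα_eq : α = 2 := by linarith
        simp [hα_eq] at hlt
      · by_contra! hβ2
        simp [max_eq_right (sub_nonpos.mpr hβ2)] at hlt
    · rintro ⟨hα2, hβ2⟩
      rw [max_eq_left (by linarith)]
      have hpos : 0 < (α - 2) * (β - 2) / (β + α - 3) :=
        div_pos (mul_pos (by linarith) (by linarith)) (by linarith)
      linarith
end

section
/- For all real numbers α ≥ 0 and β ≥ 0, one has d_S(α,β) > min{1, max{1−α/2, α/2}} if and only if (0 < α < 2 and β > 2·max{1−α/2, α/2}). -/
/-- For the S-channel, cooperation strictly improves the gDoF iff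
0 < α < 2 and β > 2·max{1−α/2, α/2}. -/
theorem stmt_14 (α β : ℝ) (hα : 0 ≤ α) (hβ : 0 ≤ β) :
    dS α β > min 1 (max (1 - α/2) (α/2)) ↔
      ((0 < α ∧ α < 2) ∧ β > 2 * max (1 - α/2) (α/2)) := by
  unfold dS
  split_ifs with h1 h2
  · rw [max_eq_left (by linarith : α/2 ≤ 1 - α/2), min_eq_right (by linarith : 1 - α/2 ≤ 1)]
    constructor
    · intro h
      rcases le_or_gt (α + β - 2) 0 with hc | hc
      · simp [max_eq_right hc] at h
      · rcases hα.eq_or_lt with rfl | h0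
        · simp at h
        · exact ⟨⟨h0, by linarith⟩, by linarith⟩
    · rintro ⟨⟨h0, -⟩, hb⟩
      have hc : 0 < α + β - 2 := by linarith
      have hd : 0 < β + α - 1 := by linarith
      rw [max_eq_left hc.le]
      have : 0 < α * (α + β - 2) / (β + α - 1) := by positivity
      linarith
  · rw [max_eq_right (by linarith : 1 - α/2 ≤ α/2), min_eq_right (by linarith : α/2 ≤ 1)]
    constructor
    · intro h
      rcases le_or_gt (β - α) 0 with hc | hc
      · simp [max_eq_right hc] at h
      · exact ⟨⟨by linarith, h2⟩, by linarith⟩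
    · rintro ⟨-, hb⟩
      have hc : 0 < β - α := by linarith
      have h2' : 0 < 2 - α := by linarith
      rw [max_eq_left hc.le]
      have : 0 < (2 - α) * (β - α) / (β - α + 1) := by positivity
      linarith
  · rw [max_eq_right (by linarith : 1 - α/2 ≤ α/2), min_eq_left (by linarith : 1 ≤ α/2)]
    exact ⟨fun h => absurd h (lt_irrefl _), fun h => absurd h.1.2 h2⟩
end

section
/- For all real numbers α ≥ 0 and β ≥ 0, one has d_Z(α,β) ≥ d_SYM(α,β). -/
theorem half_mul_mul_max_div_le {c x y : ℝ} (hc : 0 ≤ c) (hxy : 0 < x → x ≤ y) :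
    (1/2) * (c * max x 0 / y) ≤ c / 2 := by
  have h : max x 0 / y ≤ 1 := by
    rcases le_or_gt x 0 with hx | hx
    · simp [max_eq_right hx]
    · rw [max_eq_left hx.le]
      exact div_le_one_of_le₀ (hxy hx) (hx.le.trans (hxy hx))
  rw [mul_div_assoc]
  linarith [mul_le_of_le_one_right hc h]

/-- The gDoF of the Z-channel is at least that of the interference-symmetric channel. -/
theorem stmt_15 (α β : ℝ) (hα : 0 ≤ α) (hβ : 0 ≤ β) :
    dZ α β ≥ dSYM α β := by
  unfold dZ dSYM
  split_ifs with h2 h1 h3 <;> try linarith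
  · have := half_mul_mul_max_div_le (x := β - 2 + 2*α) (y := β + α - 1) hα
      (fun _ => by linarith)
    exact le_max_of_le_left (by linarith)
  · have := half_mul_mul_max_div_le (c := 2 - 3*α) (x := β - 2*α) (y := β - 3*α + 1)
      (by linarith) (fun _ => by linarith)
    exact le_max_of_le_left (by linarith)
end

section
/- For all real numbers α and β with 0 ≤ α ≤ 2/3 and β ≥ 0, one has d_S(α,β) ≥ d_SYM(α,β). -/
/-- The cooperation gain of the S-channel is nonnegative. -/
lemma max_div_sub_one_nonneg (x : ℝ) : 0 ≤ max (x - 2) 0 / (x - 1) := by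
  rcases le_total (x - 2) 0 with h | h
  · simp [max_eq_right h]
  · exact div_nonneg (le_max_right _ _) (by linarith)

lemma max_zero_div_le_one {n d : ℝ} (h : n ≤ d) : max n 0 / d ≤ 1 := by
  rcases le_total n 0 with hn | hn
  · simp [max_eq_right hn]
  · rw [max_eq_left hn]
    exact div_le_one_of_le₀ h (hn.trans h)

/-- For 0 ≤ α ≤ 2/3 the S-channel gDoF dominates the interference-symmetric one. -/
theorem stmt_16 (α β : ℝ) (hα₁ : 0 ≤ α) (hα₂ : α ≤ 2/3) (hβ : 0 ≤ β) :
    dS α β ≥ dSYM α β := by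
  have hS : 0 ≤ max (α + β - 2) 0 / (β + α - 1) := by
    simpa only [add_comm α β] using max_div_sub_one_nonneg (β + α)
  have hαS := mul_nonneg hα₁ hS
  unfold dS dSYM
  rw [if_pos (by linarith : α < 1)]
  simp only [mul_div_assoc]
  split_ifs with h₁ h₂ h₃
  · have h := mul_le_mul_of_nonneg_left
      (max_zero_div_le_one (by linarith : β - 2 + 2 * α ≤ β + α - 1)) hα₁
    linarith
  · have h := mul_le_mul_of_nonneg_left
      (max_zero_div_le_one (by linarith : β - 2 * α ≤ β - 3 * α + 1))
      (by linarith : 0 ≤ 2 - 3 * α)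
    linarith
  · rw [max_eq_left (by linarith : α / 2 ≤ 1 - α / 2)]
    linarith
  · linarith
end

section
/- Let α > 2 and β > 2 be real numbers. For snr > 0 define x(snr) := log₂(1 + snr^α/(1+snr)²) and γ′(snr) := x(snr)/( log₂(1 + snr^β/(1+snr)) + x(snr) ). Then γ′(snr) converges to (α−2)/(β+α−3) as snr → +∞. -/
open Real Filter

/-- A function asymptotic to `s ^ c` up to a nonzero constant has logarithmic order `c`. -/
theorem tendsto_logb_div_logb_of_tendsto_div_rpow {b c L : ℝ} (hb : 1 < b) (hL : L ≠ 0)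
    {f : ℝ → ℝ} (hf : Tendsto (fun s => f s / s ^ c) atTop (nhds L)) :
    Tendsto (fun s => Real.logb b (f s) / Real.logb b s) atTop (nhds c) := by
  have hlog : Tendsto (fun s => Real.logb b (f s / s ^ c)) atTop (nhds (Real.logb b L)) :=
    (hf.log hL).div_const _
  have h := (hlog.div_atTop (Real.tendsto_logb_atTop hb)).const_add c
  rw [add_zero] at h
  refine h.congr' ?_
  filter_upwards [eventually_gt_atTop 1, hf.eventually_ne hL] with s hs hne
  have hs0 : 0 < s := one_pos.trans hs
  have hfs : f s ≠ 0 := fun h0 => hne (by simp [h0])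
  have hls : Real.logb b s ≠ 0 := (Real.logb_pos hb hs).ne'
  rw [Real.logb_div hfs (Real.rpow_pos_of_pos hs0 c).ne', Real.logb_rpow_eq_mul_logb_of_pos hs0]
  field_simp
  ring

theorem tendsto_logb_one_add_rpow_div_pow {b a : ℝ} (hb : 1 < b) {n : ℕ} (ha : (n : ℝ) < a) :
    Tendsto (fun s : ℝ => Real.logb b (1 + s ^ a / (1 + s) ^ n) / Real.logb b s)
      atTop (nhds (a - n)) := by
  refine tendsto_logb_div_logb_of_tendsto_div_rpow hb one_ne_zero ?_
  have hinv : Tendsto (fun s : ℝ => (s⁻¹ + 1)⁻¹ ^ n) atTop (nhds 1) := by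
    simpa using ((tendsto_inv_atTop_zero.add_const (1 : ℝ)).inv₀ (by norm_num)).pow n
  have h := (tendsto_rpow_neg_atTop (sub_pos.2 ha)).add hinv
  rw [zero_add] at h
  refine h.congr' ?_
  filter_upwards [eventually_gt_atTop 0] with s hs
  have hsa := (Real.rpow_pos_of_pos hs a).ne'
  have hs1 : 1 + s ≠ 0 := by positivity
  have hq : (s⁻¹ + 1)⁻¹ = s / (1 + s) := by field_simp
  rw [hq, Real.rpow_neg hs.le, Real.rpow_sub hs, Real.rpow_natCast, div_pow]
  field_simp

/-- The listening fraction γ′(snr) of the Regime-3 achievable scheme converges to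
the gDoF-optimal listening fraction (α−2)/(β+α−3) as snr → ∞. -/
theorem stmt_19 (α β : ℝ) (hα : 2 < α) (hβ : 2 < β) :
    Tendsto (fun snr : ℝ =>
        Real.logb 2 (1 + snr ^ α / (1 + snr) ^ 2) /
          (Real.logb 2 (1 + snr ^ β / (1 + snr)) +
            Real.logb 2 (1 + snr ^ α / (1 + snr) ^ 2)))
      atTop (nhds ((α - 2) / (β + α - 3))) := by
  have hx := tendsto_logb_one_add_rpow_div_pow one_lt_two (n := 2) (a := α) (by exact_mod_cast hα)
  have hy := tendsto_logb_one_add_rpow_div_pow one_lt_two (n := 1) (a := β)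
    (by push_cast; linarith)
  simp only [pow_one, Nat.cast_one, Nat.cast_ofNat] at hx hy
  have h := hx.div (hy.add hx) (by linarith)
  rw [show β - 1 + (α - 2) = β + α - 3 by ring] at h
  refine h.congr' ?_
  filter_upwards [eventually_gt_atTop 1] with s hs
  rw [Pi.div_apply, ← add_div, div_div_div_cancel_right₀ (Real.logb_pos one_lt_two hs).ne']
end
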